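/- (Corollary 5.5.) If a weight w belongs to A_∞, then there exists ε > 0 such that w^ε belongs to A_2. -/

import Mathlib

open MeasureTheory

/-- The collection of open balls `B(x, ρ)` (with `ρ > 0`) such that the doubled ball
`B(x, 2ρ)` is contained in `Ω`. -/
def ballsIn {n : ℕ} (Ω : Set (EuclideanSpace ℝ (Fin n))) :
    Set (Set (EuclideanSpace ℝ (Fin n))) :=
  {B | ∃ x ρ, 0 < ρ ∧ B = Metric.ball x ρ ∧ Metric.ball x (2 * ρ) ⊆ Ω}

/-- A weight on `Ω`: a measurable function that is positive a.e. on `Ω`. -/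
def IsWeight {n : ℕ} (Ω : Set (EuclideanSpace ℝ (Fin n)))
    (w : EuclideanSpace ℝ (Fin n) → ℝ) : Prop :=
  Measurable w ∧ ∀ᵐ x ∂volume, x ∈ Ω → 0 < w x

/-- The `p`-mean of `w` over `B`, for an extended-real exponent `p`. -/
noncomputable def pMean {n : ℕ} (w : EuclideanSpace ℝ (Fin n) → ℝ) (p : EReal)
    (B : Set (EuclideanSpace ℝ (Fin n))) : ℝ :=
  if p = ⊤ then essSup w (volume.restrict B)
  else if p = ⊥ then essInf w (volume.restrict B)
  else if p = 0 then Real.exp (⨍ x in B, Real.log (w x))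
  else (⨍ x in B, (w x) ^ p.toReal) ^ (1 / p.toReal)

open Classical in
/-- Finiteness of the `p`-mean of `w` over `B`. -/
def MeanFinite {n : ℕ} (w : EuclideanSpace ℝ (Fin n) → ℝ) (p : EReal)
    (B : Set (EuclideanSpace ℝ (Fin n))) : Prop :=
  if p = ⊤ then ∃ M : ℝ, ∀ᵐ x ∂(volume.restrict B), w x ≤ M
  else if p = ⊥ then ∃ m : ℝ, ∀ᵐ x ∂(volume.restrict B), m ≤ w x
  else if p = 0 then IntegrableOn (fun x => Real.log (w x)) B
  else IntegrableOn (fun x => (w x) ^ p.toReal) B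

/-- `w ∈ RC(r, s, C)` over `Ω`: for every admissible ball the `r`- and `s`-means are finite
and `w(s,B) ≤ C · w(r,B)`. -/
def MemRC {n : ℕ} (Ω : Set (EuclideanSpace ℝ (Fin n)))
    (w : EuclideanSpace ℝ (Fin n) → ℝ) (r s : EReal) (C : ℝ) : Prop :=
  ∀ B ∈ ballsIn Ω, MeanFinite w r B ∧ MeanFinite w s B ∧ pMean w s B ≤ C * pMean w r B

/-- `w ∈ RC(r,s) = ⋃_{C ≥ 1} RC(r,s,C)`. -/
def InRC {n : ℕ} (Ω : Set (EuclideanSpace ℝ (Fin n)))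
    (w : EuclideanSpace ℝ (Fin n) → ℝ) (r s : EReal) : Prop :=
  ∃ C : ℝ, 1 ≤ C ∧ MemRC Ω w r s C

/-- `[w]_{RC(r,s)}`, the least admissible reversal constant. -/
noncomputable def RCconst {n : ℕ} (Ω : Set (EuclideanSpace ℝ (Fin n)))
    (w : EuclideanSpace ℝ (Fin n) → ℝ) (r s : EReal) : ℝ :=
  sInf {C : ℝ | 1 ≤ C ∧ MemRC Ω w r s C}


open Metric Set Filter Topology

theorem aux_avg_dist {α : Type*} [MeasurableSpace α] {μ : Measure α} {f : α → ℝ} {S T : Set α}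
    (hST : S ⊆ T) (hf : IntegrableOn f T μ) (hT : μ T ≠ ⊤) (c κ : ℝ)
    (hκ : ∫ y in T, |f y - c| ∂μ ≤ κ) (hS : 0 < μ.real S) :
    |(⨍ y in S, f y ∂μ) - c| ≤ κ / μ.real S := by
  have hSf : μ S ≠ ⊤ := ne_top_of_le_ne_top hT (measure_mono hST)
  have hi : IntegrableOn (fun y => f y - c) T μ := hf.sub (integrableOn_const hT)
  have h1 : (⨍ y in S, f y ∂μ) - c = (μ.real S)⁻¹ * ∫ y in S, (f y - c) ∂μ := by
    rw [integral_sub (hf.mono_set hST) (integrableOn_const hSf), setAverage_eq]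
    simp only [smul_eq_mul, setIntegral_const]
    field_simp
  rw [h1, abs_mul, abs_of_pos (inv_pos.2 hS), div_eq_inv_mul]
  gcongr
  refine (abs_integral_le_integral_abs).trans (le_trans ?_ hκ)
  exact setIntegral_mono_set hi.abs (Eventually.of_forall fun _ => abs_nonneg _)
    (LE.le.eventuallyLE hST)

abbrev Eu (n : ℕ) := EuclideanSpace ℝ (Fin n)

theorem aux_vol {n : ℕ} (x y : Eu n) {r a : ℝ} (hr : 0 < r) (ha : 0 ≤ a) :
    volume.real (closedBall x (a * r)) = a ^ n * volume.real (closedBall y r) := by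
  rw [Measure.addHaar_real_closedBall _ _ (by positivity),
    Measure.addHaar_real_closedBall _ _ hr.le]
  simp only [finrank_euclideanSpace, Fintype.card_fin]
  ring

theorem aux_vol_pos {n : ℕ} (x : Eu n) {r : ℝ} (hr : 0 < r) :
    0 < volume.real (closedBall x r) := by
  exact ENNReal.toReal_pos (measure_closedBall_pos _ _ hr).ne' measure_closedBall_lt_top.ne

def BMOloc {n : ℕ} (Ω : Set (Eu n)) (f : Eu n → ℝ) (K : ℝ) : Prop :=
  ∀ x r, 0 < r → ball x (2 * r) ⊆ Ω → IntegrableOn f (closedBall x r) ∧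
    ∫ y in closedBall x r, |f y - ⨍ z in closedBall x r, f z| ≤ K * volume.real (closedBall x r)

def DistB {n : ℕ} (Ω : Set (Eu n)) (f : Eu n → ℝ) (t q : ℝ) : Prop :=
  ∀ x r, 0 < r → ball x (4 * r) ⊆ Ω →
    volume {y | y ∈ closedBall x r ∧ t < |f y - ⨍ z in closedBall x (2 * r), f z|} ≤
      ENNReal.ofReal q * volume (closedBall x r)

theorem dist_step {n : ℕ} {Ω : Set (Eu n)} {f : Eu n → ℝ} {K t q : ℝ} (hK : 0 < K)
    (ht : 0 ≤ t) (hq : 0 ≤ q) (H : BMOloc Ω f K) (hD : DistB Ω f t q) :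
    DistB Ω f (t + 2 * 10 ^ n * K) (q / 2) := by
  intro x0 ρ hρ hsub
  set lam : ℝ := 2 * 10 ^ n * K with hlam
  have hlpos : 0 < lam := by positivity
  obtain ⟨hint, hosc⟩ := H x0 (2 * ρ) (by positivity) (by rwa [← mul_assoc, show (2:ℝ) * 2 = 4 by norm_num])
  set c := ⨍ z in closedBall x0 (2 * ρ), f z with hc
  have hgint : IntegrableOn (fun y => |f y - c|) (closedBall x0 (2 * ρ)) :=
    (hint.sub (integrableOn_const measure_closedBall_lt_top.ne)).abs
  set a : ℕ → ℝ := fun k => (ρ / 2) * (1 / 10) ^ k with ha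
  have hapos : ∀ k, 0 < a k := fun k => by simp only [ha]; positivity
  have hale : ∀ k, a k ≤ ρ / 2 := fun k => by
    simp only [ha]
    have : (1 / 10 : ℝ) ^ k ≤ 1 := pow_le_one₀ (by norm_num) (by norm_num)
    nlinarith
  have hatend : Tendsto a atTop (𝓝[>] 0) := by
    refine tendsto_nhdsWithin_iff.2 ⟨?_, Eventually.of_forall hapos⟩
    have := (tendsto_pow_atTop_nhds_zero_of_lt_one (r := (1 / 10 : ℝ)) (by norm_num) (by norm_num)).const_mul (ρ / 2)
    simpa [ha] using this
  have hin : ∀ x ∈ closedBall x0 ρ, ∀ k, closedBall x (a k) ⊆ closedBall x0 (2 * ρ) := by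
    intro x hx k
    apply closedBall_subset_closedBall'
    have := hale k
    rw [mem_closedBall] at hx
    linarith
  -- stopping
  set A : Eu n → ℕ → Prop := fun x k =>
    lam * volume.real (closedBall x (a k)) < ∫ y in closedBall x (a k), |f y - c| with hA
  have hhalt : ∀ᵐ x, x ∈ closedBall x0 ρ → lam < |f x - c| → ∃ k, A x k := by
    have hG : LocallyIntegrable ((closedBall x0 (2 * ρ)).indicator (fun y => |f y - c|))
        (volume : Measure (Eu n)) :=
      (hgint.integrable_indicator measurableSet_closedBall).locallyIntegrable
    filter_upwards [IsUnifLocDoublingMeasure.ae_tendsto_average volume hG 1] with x hx hxB hxl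
    by_contra! hcon
    have h1 := hx (fun _ => x) a hatend (Eventually.of_forall fun k => by
      simpa using (hapos k).le)
    have hx2 : x ∈ closedBall x0 (2 * ρ) := closedBall_subset_closedBall (by linarith) hxB
    rw [indicator_of_mem hx2] at h1
    refine absurd (le_of_tendsto h1 (Eventually.of_forall fun k => ?_)) (not_le.2 hxl)
    have h2 : ∫ y in closedBall x (a k), (closedBall x0 (2 * ρ)).indicator (fun y => |f y - c|) y
        = ∫ y in closedBall x (a k), |f y - c| :=
      setIntegral_congr_fun measurableSet_closedBall fun y hy =>
        indicator_of_mem (hin x hxB k hy) _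
    rw [setAverage_eq, h2, smul_eq_mul, inv_mul_le_iff₀ (aux_vol_pos x (hapos k)), mul_comm]
    exact not_lt.1 (hcon k)
  have hA0 : ∀ x ∈ closedBall x0 ρ, ¬ A x 0 := by
    intro x hx
    simp only [hA, not_lt]
    have h1 : ∫ y in closedBall x (a 0), |f y - c| ≤ ∫ y in closedBall x0 (2 * ρ), |f y - c| :=
      setIntegral_mono_set hgint (Eventually.of_forall fun _ => abs_nonneg _)
        (LE.le.eventuallyLE (hin x hx 0))
    refine h1.trans (hosc.trans ?_)
    have h2 := aux_vol x0 x (r := a 0) (a := 4) (hapos 0) (by norm_num)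
    have h3 : 4 * a 0 = 2 * ρ := by simp [ha]; ring
    rw [h3] at h2
    rw [h2, hlam, ← mul_assoc]
    gcongr ?_ * _
    have : (4:ℝ) ^ n ≤ 10 ^ n := by gcongr; norm_num
    nlinarith
  -- stopping set
  set T : Set (Eu n × ℕ) := {p | p.1 ∈ closedBall x0 ρ ∧ A p.1 (p.2 + 1) ∧ ¬ A p.1 p.2} with hT
  obtain ⟨u, huT, hdisj, hcov⟩ := Vitali.exists_disjoint_subfamily_covering_enlargement_closedBall
    T (fun p => p.1) (fun p => a (p.2 + 1)) (ρ / 2) (fun p _ => hale _) 5 (by norm_num)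
  have hucount : u.Countable := hdisj.countable_of_nonempty_interior fun p _ =>
    ⟨p.1, ball_subset_interior_closedBall (mem_ball_self (hapos _))⟩
  have hstep : ∀ k, a k = 2 * (5 * a (k + 1)) := fun k => by simp only [ha, pow_succ]; ring
  have hmain : ({y | y ∈ closedBall x0 ρ ∧ t + lam < |f y - c|} : Set (Eu n)) ≤ᵐ[volume]
      ⋃ p ∈ u, {y | y ∈ closedBall p.1 (5 * a (p.2 + 1)) ∧
        t < |f y - ⨍ z in closedBall p.1 (2 * (5 * a (p.2 + 1))), f z|} := by
    filter_upwards [hhalt] with x hx hxm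
    obtain ⟨hxB, hxt⟩ := hxm
    have hex := hx hxB (by linarith)
    classical
    obtain ⟨k, hk, hkmin⟩ : ∃ k, A x k ∧ ∀ m < k, ¬ A x m :=
      ⟨Nat.find hex, Nat.find_spec hex, fun m hm => Nat.find_min hex hm⟩
    obtain _ | k := k
    · exact absurd hk (hA0 x hxB)
    obtain ⟨p, hpu, hp⟩ := hcov (x, k) ⟨hxB, hk, hkmin k (Nat.lt_succ_self k)⟩
    have hpT := huT hpu
    refine mem_iUnion₂.2 ⟨p, hpu, hp (mem_closedBall_self (hapos _).le), ?_⟩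
    rw [← hstep]
    have h5 := aux_avg_dist (μ := volume) (f := f) (Subset.refl (closedBall p.1 (a p.2)))
      (hint.mono_set (hin _ hpT.1 _)) measure_closedBall_lt_top.ne c _
      (not_lt.1 hpT.2.2) (aux_vol_pos _ (hapos _))
    rw [mul_div_assoc, div_self (aux_vol_pos _ (hapos _)).ne', mul_one] at h5
    have h6 := abs_sub_le (f x) (⨍ z in closedBall p.1 (a p.2), f z) c
    linarith
  have hball : ∀ p ∈ u, volume {y | y ∈ closedBall p.1 (5 * a (p.2 + 1)) ∧
        t < |f y - ⨍ z in closedBall p.1 (2 * (5 * a (p.2 + 1))), f z|} ≤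
      ENNReal.ofReal (q * 5 ^ n * lam⁻¹) *
        ∫⁻ y in closedBall p.1 (a (p.2 + 1)), ENNReal.ofReal |f y - c| := by
    intro p hp
    have hpT := huT hp
    have h5a : 5 * a (p.2 + 1) ≤ ρ / 2 := by
      have := hstep p.2; have := hale p.2; have := hapos p.2; linarith
    refine (hD p.1 _ (mul_pos (by norm_num) (hapos _)) ?_).trans ?_
    · refine Subset.trans (ball_subset_ball' ?_) hsub
      have := mem_closedBall.1 hpT.1
      linarith
    · rw [← ofReal_integral_eq_lintegral_ofReal (hgint.mono_set (hin _ hpT.1 _))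
        (Eventually.of_forall fun _ => abs_nonneg _), ← ENNReal.ofReal_mul (by positivity),
        ← ENNReal.ofReal_toReal (measure_closedBall_lt_top (x := p.1) (r := 5 * a (p.2 + 1))).ne,
        ← ENNReal.ofReal_mul hq]
      apply ENNReal.ofReal_le_ofReal
      change q * volume.real _ ≤ _
      rw [aux_vol p.1 p.1 (hapos _) (by norm_num)]
      have h7 : volume.real (closedBall p.1 (a (p.2 + 1))) ≤
          lam⁻¹ * ∫ y in closedBall p.1 (a (p.2 + 1)), |f y - c| := by
        rw [le_inv_mul_iff₀ hlpos]; exact hpT.2.1.le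
      calc _ = q * 5 ^ n * volume.real (closedBall p.1 (a (p.2 + 1))) := by ring
        _ ≤ q * 5 ^ n * (lam⁻¹ * ∫ y in closedBall p.1 (a (p.2 + 1)), |f y - c|) := by gcongr
        _ = _ := by ring
  calc volume {y | y ∈ closedBall x0 ρ ∧ t + lam < |f y - c|}
      ≤ _ := measure_mono_ae hmain
    _ ≤ _ := measure_biUnion_le _ hucount _
    _ ≤ ∑' p : u, ENNReal.ofReal (q * 5 ^ n * lam⁻¹) *
        ∫⁻ y in closedBall p.1.1 (a (p.1.2 + 1)), ENNReal.ofReal |f y - c| :=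
        ENNReal.tsum_le_tsum fun p => hball p.1 p.2
    _ = ENNReal.ofReal (q * 5 ^ n * lam⁻¹) *
        ∫⁻ y in ⋃ p ∈ u, closedBall p.1 (a (p.2 + 1)), ENNReal.ofReal |f y - c| := by
        rw [ENNReal.tsum_mul_left, lintegral_biUnion hucount (fun _ _ => measurableSet_closedBall) hdisj]
    _ ≤ ENNReal.ofReal (q * 5 ^ n * lam⁻¹) *
        ∫⁻ y in closedBall x0 (2 * ρ), ENNReal.ofReal |f y - c| := by
        gcongr
        exact iUnion₂_subset fun p hp => hin _ (huT hp).1 _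
    _ ≤ _ := by
        rw [← ofReal_integral_eq_lintegral_ofReal hgint
          (Eventually.of_forall fun _ => abs_nonneg _), ← ENNReal.ofReal_mul (by positivity),
          ← ENNReal.ofReal_toReal (measure_closedBall_lt_top (x := x0) (r := ρ)).ne,
          ← ENNReal.ofReal_mul (by positivity)]
        apply ENNReal.ofReal_le_ofReal
        change _ ≤ q / 2 * volume.real _
        rw [aux_vol x0 x0 hρ (by norm_num)] at hosc
        calc _ ≤ q * 5 ^ n * lam⁻¹ * (K * (2 ^ n * volume.real (closedBall x0 ρ))) := by gcongr
          _ = _ := by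
            rw [hlam, show (10:ℝ) = 5 * 2 by norm_num, mul_pow]
            field_simp

theorem dist_all {n : ℕ} {Ω : Set (Eu n)} {f : Eu n → ℝ} {K : ℝ} (hK : 0 < K)
    (H : BMOloc Ω f K) (k : ℕ) : DistB Ω f (k * (2 * 10 ^ n * K)) ((1 / 2) ^ k) := by
  induction k with
  | zero =>
    intro x r _ _
    simp only [pow_zero, ENNReal.ofReal_one, one_mul]
    exact measure_mono fun y hy => hy.1
  | succ k ih =>
    have := dist_step hK (by positivity) (by positivity) H ih
    convert! this using 1
    · push_cast; ring
    · ring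

theorem exp_small {n : ℕ} {Ω : Set (Eu n)} {f : Eu n → ℝ} {K : ℝ} (hK : 0 < K)
    (hf : Measurable f) (H : BMOloc Ω f K) (x : Eu n) (r : ℝ) (hr : 0 < r)
    (hsub : ball x (4 * r) ⊆ Ω) :
    ∫⁻ y in closedBall x r, ENNReal.ofReal (Real.exp (Real.log (3 / 2) / (2 * 10 ^ n * K) *
      |f y - ⨍ z in closedBall x (2 * r), f z|)) ≤ 7 * volume (closedBall x r) := by
  set c := ⨍ z in closedBall x (2 * r), f z with hc
  set lam : ℝ := 2 * 10 ^ n * K with hlam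
  have hlpos : 0 < lam := by positivity
  have hlog : 0 < Real.log (3 / 2) := Real.log_pos (by norm_num)
  have hms : ∀ k : ℕ, MeasurableSet {y | (k : ℝ) * lam < |f y - c|} := fun k =>
    measurableSet_lt measurable_const ((hf.sub_const c).abs)
  have hpt : ∀ y, ENNReal.ofReal (Real.exp (Real.log (3 / 2) / lam * |f y - c|)) ≤
      1 + ∑' k : ℕ, ({y | (k : ℝ) * lam < |f y - c|} : Set (Eu n)).indicator
        (fun _ => ENNReal.ofReal ((3 / 2) ^ (k + 1))) y := by
    intro y
    rcases (abs_nonneg (f y - c)).eq_or_lt with h0 | h0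
    · rw [← h0]; simp
    · obtain ⟨k, hk1, hk2⟩ : ∃ k : ℕ, (k : ℝ) * lam < |f y - c| ∧ |f y - c| ≤ (k + 1) * lam := by
        have hp : 0 < |f y - c| / lam := by positivity
        have hcp : 0 < ⌈|f y - c| / lam⌉₊ := Nat.ceil_pos.2 hp
        refine ⟨⌈|f y - c| / lam⌉₊ - 1, ?_, ?_⟩
        · rw [← lt_div_iff₀ hlpos, ← Nat.lt_ceil]; omega
        · rw [← div_le_iff₀ hlpos]
          have : ((⌈|f y - c| / lam⌉₊ - 1 : ℕ) : ℝ) + 1 = (⌈|f y - c| / lam⌉₊ : ℝ) := by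
            rw [Nat.cast_sub hcp]; simp
          rw [this]; exact Nat.le_ceil _
      refine le_trans ?_ le_add_self
      refine le_trans ?_ (ENNReal.le_tsum k)
      rw [indicator_of_mem (by exact hk1)]
      apply ENNReal.ofReal_le_ofReal
      rw [← Real.exp_log (show (0:ℝ) < 3 / 2 by norm_num), ← Real.exp_nat_mul, Real.exp_log (by norm_num)]
      apply Real.exp_le_exp.2
      rw [div_mul_eq_mul_div, div_le_iff₀ hlpos]
      push_cast
      nlinarith
  have hind : ∀ k : ℕ, ∫⁻ y in closedBall x r, ({y | (k : ℝ) * lam < |f y - c|} : Set (Eu n)).indicator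
        (fun _ => ENNReal.ofReal ((3 / 2) ^ (k + 1))) y ≤
        ENNReal.ofReal (3 / 2 * (3 / 4) ^ k) * volume (closedBall x r) := by
    intro k
    rw [lintegral_indicator_const (hms k), Measure.restrict_apply (hms k)]
    have h1 := dist_all hK H k x r hr hsub
    have h2 : {y | (k : ℝ) * lam < |f y - c|} ∩ closedBall x r =
        {y | y ∈ closedBall x r ∧ (k : ℝ) * lam < |f y - c|} := by
      ext y; exact and_comm
    rw [h2]
    calc _ ≤ ENNReal.ofReal ((3 / 2) ^ (k + 1)) * (ENNReal.ofReal ((1 / 2) ^ k) * volume (closedBall x r)) := by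
          gcongr
      _ = _ := by
          rw [← mul_assoc, ← ENNReal.ofReal_mul (by positivity)]
          congr 2
          rw [pow_succ, mul_right_comm, ← mul_pow]; norm_num [mul_comm]
  calc _ ≤ ∫⁻ y in closedBall x r, (1 + ∑' k : ℕ, ({y | (k : ℝ) * lam < |f y - c|} : Set (Eu n)).indicator
        (fun _ => ENNReal.ofReal ((3 / 2) ^ (k + 1))) y) := lintegral_mono hpt
    _ = volume (closedBall x r) + ∑' k : ℕ, ∫⁻ y in closedBall x r, ({y | (k : ℝ) * lam < |f y - c|} : Set (Eu n)).indicator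
        (fun _ => ENNReal.ofReal ((3 / 2) ^ (k + 1))) y := by
        rw [lintegral_add_left measurable_const, lintegral_tsum]
        · simp
        · exact fun k => (measurable_const.indicator (hms k)).aemeasurable
    _ ≤ volume (closedBall x r) + ∑' k : ℕ, ENNReal.ofReal (3 / 2 * (3 / 4) ^ k) * volume (closedBall x r) := by
        gcongr with k; exact hind k
    _ = _ := by
        have hs : HasSum (fun k : ℕ => (3 / 2 : ℝ) * (3 / 4) ^ k) 6 := by
          have := (hasSum_geometric_of_lt_one (r := (3 / 4 : ℝ)) (by norm_num) (by norm_num)).mul_left (3 / 2)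
          convert! this using 1; norm_num
        rw [ENNReal.tsum_mul_right, ← ENNReal.ofReal_tsum_of_nonneg (fun k => by positivity) hs.summable, hs.tsum_eq]
        rw [show ENNReal.ofReal 6 = 6 by simp]
        ring

theorem exp_big {n : ℕ} {Ω : Set (Eu n)} {f : Eu n → ℝ} {K : ℝ} (hK : 0 < K)
    (hf : Measurable f) (H : BMOloc Ω f K) : ∃ ε > 0, ∃ A : ℝ, 0 < A ∧ ∀ (x0 : Eu n) (ρ : ℝ), 0 < ρ →
    ball x0 (2 * ρ) ⊆ Ω →
    ∫⁻ y in closedBall x0 ρ, ENNReal.ofReal (Real.exp (ε * |f y - ⨍ z in closedBall x0 ρ, f z|))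
      ≤ ENNReal.ofReal A * volume (closedBall x0 ρ) := by
  obtain ⟨t, htB, htfin, htcov⟩ := (isCompact_closedBall (0 : Eu n) 1).finite_cover_balls
    (show (0:ℝ) < 1 / 8 by norm_num)
  have hlog : 0 < Real.log (3 / 2) := Real.log_pos (by norm_num)
  set ε : ℝ := Real.log (3 / 2) / (2 * 10 ^ n * K) with hε
  have hεpos : 0 < ε := by positivity
  set M : ℝ := 8 ^ n * K + 2 ^ n * K with hM
  lift t to Finset (Eu n) using htfin
  refine ⟨ε, hεpos, (t.card + 1) * (Real.exp (ε * M) * 7), by positivity, ?_⟩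
  intro x0 ρ hρ hsub
  obtain ⟨hint, hosc⟩ := H x0 ρ hρ hsub
  set c := ⨍ z in closedBall x0 ρ, f z with hc
  have hcov : closedBall x0 ρ ⊆ ⋃ i ∈ t, closedBall (x0 + ρ • i) (ρ / 8) := by
    intro y hy
    have h1 : ρ⁻¹ • (y - x0) ∈ closedBall (0 : Eu n) 1 := by
      rw [mem_closedBall_zero_iff, norm_smul, norm_inv, Real.norm_of_nonneg hρ.le,
        inv_mul_le_iff₀ hρ, mul_one, ← dist_eq_norm]
      exact hy
    obtain ⟨i, hi, hyi⟩ := mem_iUnion₂.1 (htcov h1)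
    refine mem_iUnion₂.2 ⟨i, hi, ?_⟩
    rw [mem_ball, dist_eq_norm] at hyi
    rw [mem_closedBall, dist_eq_norm]
    have : y - (x0 + ρ • i) = ρ • (ρ⁻¹ • (y - x0) - i) := by
      rw [smul_sub, smul_inv_smul₀ hρ.ne']; abel
    rw [this, norm_smul, Real.norm_of_nonneg hρ.le]
    nlinarith
  have hone : ∀ i ∈ t, ∫⁻ y in closedBall (x0 + ρ • i) (ρ / 8), ENNReal.ofReal (Real.exp (ε * |f y - c|))
      ≤ ENNReal.ofReal (Real.exp (ε * M) * 7) * volume (closedBall x0 ρ) := by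
    intro i hi
    have hi1 : ‖i‖ ≤ 1 := by simpa using htB hi
    set xi := x0 + ρ • i with hxi
    have hr : 0 < ρ / 8 := by positivity
    have hdx : dist xi x0 ≤ ρ := by
      rw [dist_eq_norm, hxi, add_sub_cancel_left, norm_smul, Real.norm_of_nonneg hρ.le]; nlinarith
    obtain ⟨hinti, hosci⟩ := H xi (2 * (ρ / 8)) (by positivity)
      (Subset.trans (ball_subset_ball' (by linarith)) hsub)
    have hexp := exp_small hK hf H xi (ρ / 8) hr (Subset.trans (ball_subset_ball' (by linarith)) hsub)
    set m := ⨍ z in closedBall xi (2 * (ρ / 8)), f z with hm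
    set z := x0 + (7 / 8 * ρ) • i with hz
    have hzx0 : dist z x0 ≤ 7 / 8 * ρ := by
      rw [dist_eq_norm, hz, add_sub_cancel_left, norm_smul, Real.norm_of_nonneg (by positivity)]; nlinarith
    have hzxi : dist z xi ≤ ρ / 8 := by
      have : z - xi = (-(ρ / 8)) • i := by
        rw [hz, hxi, add_sub_add_left_eq_sub, ← sub_smul]; congr 1; ring
      rw [dist_eq_norm, this, norm_smul, norm_neg, Real.norm_of_nonneg hr.le]; nlinarith
    have hzpos := aux_vol_pos z hr
    have e1 := aux_avg_dist (μ := volume) (f := f) (S := closedBall z (ρ / 8))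
      (closedBall_subset_closedBall' (by linarith)) hint measure_closedBall_lt_top.ne c _ hosc hzpos
    have e2 := aux_avg_dist (μ := volume) (f := f) (S := closedBall z (ρ / 8))
      (closedBall_subset_closedBall' (by linarith)) hinti measure_closedBall_lt_top.ne m _ hosci hzpos
    have v1 : volume.real (closedBall x0 ρ) = 8 ^ n * volume.real (closedBall z (ρ / 8)) := by
      rw [← aux_vol x0 z hr (by norm_num)]; congr 2; ring
    rw [v1, ← mul_assoc, mul_div_assoc, div_self hzpos.ne', mul_one] at e1
    rw [aux_vol xi z hr (by norm_num), ← mul_assoc, mul_div_assoc, div_self hzpos.ne', mul_one] at e2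
    have hmc : |m - c| ≤ M := by
      have := abs_sub_le m (⨍ y in closedBall z (ρ / 8), f y) c
      rw [abs_sub_comm] at e2
      linarith
    calc _ ≤ ∫⁻ y in closedBall xi (ρ / 8), ENNReal.ofReal (Real.exp (ε * M)) *
          ENNReal.ofReal (Real.exp (ε * |f y - m|)) := by
          refine lintegral_mono fun y => ?_
          rw [← ENNReal.ofReal_mul (by positivity), ← Real.exp_add]
          apply ENNReal.ofReal_le_ofReal
          apply Real.exp_le_exp.2
          have := abs_sub_le (f y) m c
          nlinarith
      _ = ENNReal.ofReal (Real.exp (ε * M)) * ∫⁻ y in closedBall xi (ρ / 8),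
          ENNReal.ofReal (Real.exp (ε * |f y - m|)) :=
          lintegral_const_mul' _ _ ENNReal.ofReal_ne_top
      _ ≤ ENNReal.ofReal (Real.exp (ε * M)) * (7 * volume (closedBall xi (ρ / 8))) := by gcongr
      _ ≤ ENNReal.ofReal (Real.exp (ε * M)) * (7 * volume (closedBall x0 ρ)) := by
          gcongr 2
          rw [Measure.addHaar_closedBall_center volume xi, Measure.addHaar_closedBall_center volume x0]
          gcongr
          linarith
      _ = _ := by
          rw [ENNReal.ofReal_mul (by positivity), show ENNReal.ofReal 7 = 7 by simp, mul_assoc]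
  calc _ ≤ ∫⁻ y in ⋃ i : t, closedBall (x0 + ρ • (i : Eu n)) (ρ / 8), ENNReal.ofReal (Real.exp (ε * |f y - c|)) := by
        apply lintegral_mono_set
        refine hcov.trans (iUnion₂_subset fun i hi => ?_)
        exact subset_iUnion (fun i : t => closedBall (x0 + ρ • (i : Eu n)) (ρ / 8)) ⟨i, hi⟩
    _ ≤ _ := lintegral_iUnion_le _ _
    _ ≤ ∑' i : t, ENNReal.ofReal (Real.exp (ε * M) * 7) * volume (closedBall x0 ρ) :=
        ENNReal.tsum_le_tsum fun i => hone i i.2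
    _ = t.card * (ENNReal.ofReal (Real.exp (ε * M) * 7) * volume (closedBall x0 ρ)) := by
        rw [tsum_fintype]; simp
    _ ≤ _ := by
        rw [ENNReal.ofReal_mul (p := (t.card + 1 : ℝ)) (by positivity), mul_assoc]
        gcongr
        rw [← ENNReal.ofReal_natCast]
        exact ENNReal.ofReal_le_ofReal (by linarith)

theorem ball_ae_closed {n : ℕ} (x : Eu n) {r : ℝ} (hr : 0 < r) :
    volume.restrict (ball x r) = volume.restrict (closedBall x r) := by
  apply Measure.restrict_congr_set
  exact ae_eq_of_subset_of_measure_ge ball_subset_closedBall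
    (by rw [Measure.addHaar_closedBall _ _ hr.le, Measure.addHaar_ball_of_pos _ _ hr]) measurableSet_ball.nullMeasurableSet
    measure_closedBall_lt_top.ne

theorem abs_le_two_exp (u : ℝ) : |u| ≤ 2 * Real.exp u - u := by
  have h := Real.add_one_le_exp u
  have h' := Real.exp_pos u
  rcases abs_cases u with ⟨h1, h2⟩ | ⟨h1, h2⟩ <;> rw [h1] <;> linarith

theorem ainf_bmo {n : ℕ} {Ω : Set (Eu n)} {w : Eu n → ℝ} (hw : IsWeight Ω w) {C : ℝ}
    (h : MemRC Ω w 0 1 C) : BMOloc Ω (fun x => Real.log (w x)) (2 * C) := by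
  intro x r hr hsub
  obtain ⟨h0, h1, h2⟩ := h _ ⟨x, r, hr, rfl, hsub⟩
  have e1 : (1 : EReal) ≠ ⊤ := by decide
  have e2 : (1 : EReal) ≠ ⊥ := by decide
  simp only [MeanFinite, pMean, e1, e2, if_false, one_ne_zero, EReal.toReal_one, Real.rpow_one,
    EReal.zero_ne_top, EReal.zero_ne_bot, if_true, div_one, IntegrableOn, ball_ae_closed x hr] at h0 h1 h2
  refine ⟨h0, ?_⟩
  set f := fun x => Real.log (w x) with hf
  change _ ≤ C * Real.exp (⨍ z in closedBall x r, f z) at h2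
  set c := ⨍ z in closedBall x r, f z with hc
  have hV := aux_vol_pos x hr
  have hpos : ∀ᵐ y ∂(volume.restrict (closedBall x r)), 0 < w y := by
    rw [← ball_ae_closed x hr, ae_restrict_iff' measurableSet_ball]
    filter_upwards [hw.2] with y hy hyb
    exact hy (hsub (ball_subset_ball (by linarith) hyb))
  have hcon : Integrable (fun _ : Eu n => c) (volume.restrict (closedBall x r)) :=
    integrableOn_const measure_closedBall_lt_top.ne
  have hi1 : Integrable (fun y => f y - c) (volume.restrict (closedBall x r)) := h0.sub hcon
  have hz : ∫ y in closedBall x r, (f y - c) = 0 := by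
    rw [integral_sub h0 hcon, setIntegral_const, hc, setAverage_eq]
    rw [smul_eq_mul, smul_eq_mul, mul_inv_cancel_left₀ hV.ne', sub_self]
  calc _ ≤ ∫ y in closedBall x r, (2 * Real.exp (-c) * w y - (f y - c)) := by
        refine integral_mono_ae hi1.abs ((h1.const_mul _).sub hi1) ?_
        filter_upwards [hpos] with y hy
        have := abs_le_two_exp (f y - c)
        have h3 : Real.exp (f y - c) = w y * Real.exp (-c) := by
          rw [sub_eq_add_neg, Real.exp_add]; simp only [hf, Real.exp_log hy]
        rw [h3] at this
        linarith
    _ = 2 * Real.exp (-c) * ∫ y in closedBall x r, w y := by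
        rw [integral_sub (h1.const_mul _) hi1, hz, sub_zero, integral_const_mul]
    _ ≤ 2 * Real.exp (-c) * (C * Real.exp c * volume.real (closedBall x r)) := by
        gcongr
        rw [setAverage_eq, smul_eq_mul, inv_mul_le_iff₀ hV] at h2
        linarith
    _ = _ := by
        rw [Real.exp_neg]; field_simp

/-- **Corollary 5.5.** If `w ∈ A_∞ = RC(0,1)`, then there exists `ε > 0` such that
`w^ε ∈ A₂ = RC(1/(1−2), 1) = RC(−1,1)`. -/
theorem ainf_pow_a2 {n : ℕ} (hn : 1 ≤ n)
    {Ω : Set (EuclideanSpace ℝ (Fin n))} (hΩ : IsOpen Ω)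
    {w : EuclideanSpace ℝ (Fin n) → ℝ} (hw : IsWeight Ω w)
    (h : InRC Ω w 0 1) :
    ∃ ε : ℝ, 0 < ε ∧ InRC Ω (fun x => w x ^ ε) ((1 / (1 - 2) : ℝ) : EReal) 1 := by

  obtain ⟨C, hC, hRC⟩ := h
  have hBMO := ainf_bmo hw hRC
  obtain ⟨ε, hε, A, hA, hexp⟩ := exp_big (by linarith) (Real.measurable_log.comp hw.1) hBMO
  refine ⟨ε, hε, A ^ 2 + 1, by nlinarith, ?_⟩
  rintro _ ⟨x, r, hr, rfl, hsub⟩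
  have hE := hexp x r hr hsub
  obtain ⟨hint, -⟩ := hBMO x r hr hsub
  simp only [Function.comp_def] at hE
  set c := ⨍ z in closedBall x r, Real.log (w z) with hc
  have hV := aux_vol_pos x hr
  set μ := volume.restrict (closedBall x r) with hμ
  have hpos : ∀ᵐ y ∂μ, 0 < w y := by
    rw [hμ, ← ball_ae_closed x hr, ae_restrict_iff' measurableSet_ball]
    filter_upwards [hw.2] with y hy hyb
    exact hy (hsub (ball_subset_ball (by linarith) hyb))
  have hgm : Measurable (fun y => Real.exp (ε * |Real.log (w y) - c|)) :=
    (((Real.measurable_log.comp hw.1).sub_const c).abs.const_mul ε).exp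
  have hlt : ENNReal.ofReal A * volume (closedBall x r) < ⊤ :=
    ENNReal.mul_lt_top ENNReal.ofReal_lt_top measure_closedBall_lt_top
  have hgi : Integrable (fun y => Real.exp (ε * |Real.log (w y) - c|)) μ := by
    refine ⟨hgm.aestronglyMeasurable, ?_⟩
    rw [hasFiniteIntegral_iff_ofReal (Eventually.of_forall fun _ => (Real.exp_pos _).le)]
    exact hE.trans_lt hlt
  have hgb : ∫ y, Real.exp (ε * |Real.log (w y) - c|) ∂μ ≤ A * volume.real (closedBall x r) := by
    rw [integral_eq_lintegral_of_nonneg_ae (Eventually.of_forall fun _ => (Real.exp_pos _).le)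
      hgm.aestronglyMeasurable]
    refine (ENNReal.toReal_mono hlt.ne hE).trans ?_
    rw [ENNReal.toReal_mul, ENNReal.toReal_ofReal hA.le]
    rfl
  have hb : ∀ s : ℝ, |s| = ε → ∀ᵐ y ∂μ, w y ^ s ≤
      Real.exp (s * c) * Real.exp (ε * |Real.log (w y) - c|) := by
    intro s hs
    filter_upwards [hpos] with y hy
    rw [Real.rpow_def_of_pos hy, ← Real.exp_add]
    apply Real.exp_le_exp.2
    have := le_abs_self (s * (Real.log (w y) - c))
    rw [abs_mul, hs] at this
    linarith
  have hI : ∀ s : ℝ, |s| = ε → Integrable (fun y => w y ^ s) μ := by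
    intro s hs
    refine (hgi.const_mul (Real.exp (s * c))).mono' (hw.1.pow_const s).aestronglyMeasurable ?_
    filter_upwards [hb s hs, hpos] with y hy hy'
    rwa [Real.norm_of_nonneg (by positivity)]
  have hM : ∀ s : ℝ, |s| = ε → ⨍ y in closedBall x r, w y ^ s ≤ A * Real.exp (s * c) := by
    intro s hs
    rw [setAverage_eq, smul_eq_mul, inv_mul_le_iff₀ hV]
    refine (integral_mono_ae (hI s hs) (hgi.const_mul _) (hb s hs)).trans ?_
    rw [integral_const_mul]
    calc _ ≤ Real.exp (s * c) * (A * volume.real (closedBall x r)) := by gcongr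
      _ = _ := by ring
  have hs1 : |ε| = ε := abs_of_pos hε
  have hs2 : |-ε| = ε := by rw [abs_neg, hs1]
  have hcongr : ∀ᵐ y ∂μ, (w y ^ ε) ^ (-1 : ℝ) = w y ^ (-ε) := by
    filter_upwards [hpos] with y hy
    rw [← Real.rpow_mul hy.le]; simp
  have hlow : 0 < ⨍ y in closedBall x r, w y ^ (-ε) := by
    rw [setAverage_eq, smul_eq_mul]
    refine mul_pos (inv_pos.2 hV) ?_
    rw [integral_pos_iff_support_of_nonneg_ae]
    · have : (Function.support fun y => w y ^ (-ε)) =ᵐ[μ] univ := by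
        rw [eventuallyEq_univ]
        filter_upwards [hpos] with y hy
        exact (Real.rpow_pos_of_pos hy _).ne'
      rw [measure_congr this, hμ, Measure.restrict_apply_univ]
      exact measure_closedBall_pos _ _ hr
    · filter_upwards [hpos] with y hy
      exact (Real.rpow_pos_of_pos hy _).le
    · exact hI _ hs2
  have e1 : (1 : EReal) ≠ ⊤ := by decide
  have e2 : (1 : EReal) ≠ ⊥ := by decide
  have e3 : ((1 / (1 - 2) : ℝ) : EReal) ≠ 0 := by
    rw [← EReal.coe_zero, Ne, EReal.coe_eq_coe_iff]; norm_num
  have e4 : (1 / (1 - 2) : ℝ) = -1 := by norm_num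
  simp only [MeanFinite, pMean, e1, e2, e3, if_false, one_ne_zero, EReal.toReal_one, Real.rpow_one,
    EReal.coe_ne_top, EReal.coe_ne_bot, div_one, EReal.toReal_coe, IntegrableOn, ball_ae_closed x hr]
  rw [e4]
  refine ⟨(hI _ hs2).congr (hcongr.mono fun y hy => hy.symm), hI _ hs1, ?_⟩
  rw [average_congr hcongr, show (1 / (-1) : ℝ) = -1 by norm_num, Real.rpow_neg_one,
    ← div_eq_mul_inv, le_div_iff₀ hlow]
  have m1 := hM ε hs1
  have m2 := hM (-ε) hs2
  calc _ ≤ (A * Real.exp (ε * c)) * (A * Real.exp (-ε * c)) := by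
        apply mul_le_mul m1 m2 hlow.le (by positivity)
    _ = A ^ 2 * Real.exp (ε * c + -ε * c) := by rw [Real.exp_add]; ring
    _ ≤ _ := by simp
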